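/- Let V be a real vector space, a : V × V → ℝ a symmetric positive semidefinite bilinear form with induced energy seminorm ‖v‖_A := (a(v,v))^{1/2}, m : V × V → ℝ a symmetric bilinear form, W ⊆ V a linear subspace, and C, C_k : V → V linear maps whose ranges are contained in W. Assume a(v − C v, w) = 0 for all v ∈ V, w ∈ W; ‖C v‖_A ≤ ‖v‖_A, ‖C_k v‖_A ≤ ‖v‖_A, and ‖(C − C_k)v‖_A ≤ g‖v‖_A for all v ∈ V; and |m(v, w)| ≤ δ‖v‖_A‖w‖_A for all v ∈ V, w ∈ W, with constants g, δ ≥ 0. Let λ ∈ ℝ and u ∈ V satisfy a(u, w) = λ m(u, w) for all w ∈ V. Let v_H ∈ V with v^ms := v_H − C_k v_H, m(v^ms, v^ms) = 1 and m(v_H, v_H) ≠ 0, and set Λ := a(v^ms, v_H)/m(v_H, v_H). Then Λ − λ ≤ [a(u − v^ms, u − v^ms) − λ m(u − v^ms, u − v^ms)] + g‖v_H‖_A² + |Λ| · δ(3 + 4g + g²)‖v_H‖_A². -/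

import Mathlib

/-- Cauchy–Schwarz inequality for a symmetric positive semidefinite real bilinear form, in terms
of the induced seminorm. -/
theorem LinearMap.abs_apply_le_sqrt_mul_sqrt {V : Type*} [AddCommGroup V] [Module ℝ V]
    (a : V →ₗ[ℝ] V →ₗ[ℝ] ℝ) (ha : ∀ v w, a v w = a w v) (hpsd : ∀ v, 0 ≤ a v v) (v w : V) :
    |a v w| ≤ Real.sqrt (a v v) * Real.sqrt (a w w) := by
  rw [← Real.sqrt_mul (hpsd v)]
  refine Real.abs_le_sqrt ?_
  have h := LinearMap.BilinForm.apply_mul_apply_le_of_forall_zero_le a hpsd v w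
  rwa [ha w v, ← sq] at h

/-- For an eigenpair `(lam, u)` of symmetric forms, the shifted quadratic form of the error
`u - x` equals that of `x`. -/
theorem LinearMap.apply_sub_sub_eigenvector {V : Type*} [AddCommGroup V] [Module ℝ V]
    (a m : V →ₗ[ℝ] V →ₗ[ℝ] ℝ) (ha : ∀ v w, a v w = a w v) (hm : ∀ v w, m v w = m w v)
    (lam : ℝ) (u : V) (heig : ∀ w, a u w = lam * m u w) (x : V) :
    a (u - x) (u - x) - lam * m (u - x) (u - x) = a x x - lam * m x x := by
  simp only [map_sub, LinearMap.sub_apply, ha x u, hm x u, heig]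
  ring

/-- For an eigenpair `(λ, u)`, a coarse function `v_H` with multiscale
modification `v^ms := v_H − C_k v_H` normalized so that `m(v^ms, v^ms) = 1`, and the
modified LOD Rayleigh quotient `Λ := a(v^ms, v_H)/m(v_H, v_H)`, under a-orthogonality of
`C`, stability of `C` and `C_k`, the localization bound `‖(C − C_k)v‖_A ≤ g‖v‖_A`, and
smallness of the mass form on `W` with constant `δ`, one has
`Λ − λ ≤ [a(u − v^ms, u − v^ms) − λ m(u − v^ms, u − v^ms)] + g‖v_H‖_A²
  + |Λ| δ (3 + 4g + g²)‖v_H‖_A²`. -/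
theorem stmt_8 {V : Type*} [AddCommGroup V] [Module ℝ V]
    (a m : V →ₗ[ℝ] V →ₗ[ℝ] ℝ)
    (ha : ∀ v w, a v w = a w v) (hpsd : ∀ v, 0 ≤ a v v)
    (hm : ∀ v w, m v w = m w v)
    (W : Submodule ℝ V) (C Ck : V →ₗ[ℝ] V)
    (hC : ∀ v, C v ∈ W) (hCk : ∀ v, Ck v ∈ W)
    (horth : ∀ v : V, ∀ w ∈ W, a (v - C v) w = 0)
    (hCstab : ∀ v : V, Real.sqrt (a (C v) (C v)) ≤ Real.sqrt (a v v))
    (hCkstab : ∀ v : V, Real.sqrt (a (Ck v) (Ck v)) ≤ Real.sqrt (a v v))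
    (g δ : ℝ) (hg : 0 ≤ g) (hδ : 0 ≤ δ)
    (hloc : ∀ v : V, Real.sqrt (a (C v - Ck v) (C v - Ck v)) ≤ g * Real.sqrt (a v v))
    (hmsmall : ∀ v : V, ∀ w ∈ W,
      |m v w| ≤ δ * Real.sqrt (a v v) * Real.sqrt (a w w))
    (lam : ℝ) (u : V) (heig : ∀ w, a u w = lam * m u w)
    (vH : V) (hnorm : m (vH - Ck vH) (vH - Ck vH) = 1) (hm0 : m vH vH ≠ 0) :
    a (vH - Ck vH) vH / m vH vH - lam ≤
      (a (u - (vH - Ck vH)) (u - (vH - Ck vH)) -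
        lam * m (u - (vH - Ck vH)) (u - (vH - Ck vH))) +
      g * Real.sqrt (a vH vH) ^ 2 +
      |a (vH - Ck vH) vH / m vH vH| * (δ * (3 + 4 * g + g ^ 2)) *
        Real.sqrt (a vH vH) ^ 2 := by
  rw [LinearMap.apply_sub_sub_eigenvector a m ha hm lam u heig, hnorm]
  set n := Real.sqrt (a vH vH)
  have hn : 0 ≤ n := Real.sqrt_nonneg _
  set Λ := a (vH - Ck vH) vH / m vH vH with hΛ
  have hquot : a (vH - Ck vH) vH = Λ * m vH vH := by
    rw [hΛ, div_mul_cancel₀ _ hm0]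
  have hcross : a (vH - Ck vH) (Ck vH) ≤ g * n ^ 2 := by
    have hsplit : a (vH - Ck vH) (Ck vH) = a (C vH - Ck vH) (Ck vH) := by
      have h := horth vH (Ck vH) (hCk vH)
      simp only [map_sub, LinearMap.sub_apply] at h ⊢
      linarith
    calc a (vH - Ck vH) (Ck vH)
        ≤ Real.sqrt (a (C vH - Ck vH) (C vH - Ck vH)) * Real.sqrt (a (Ck vH) (Ck vH)) :=
          hsplit ▸ (le_abs_self _).trans (LinearMap.abs_apply_le_sqrt_mul_sqrt a ha hpsd _ _)
      _ ≤ (g * n) * n :=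
          mul_le_mul (hloc vH) (hCkstab vH) (Real.sqrt_nonneg _) (mul_nonneg hg hn)
      _ = g * n ^ 2 := by ring
  have henergy : a (vH - Ck vH) (vH - Ck vH) =
      a (vH - Ck vH) vH - a (vH - Ck vH) (Ck vH) := map_sub _ _ _
  have hmass : |1 - m vH vH| ≤ δ * (3 + 4 * g + g ^ 2) * n ^ 2 := by
    have h₁ : |m vH (Ck vH)| ≤ δ * n * n :=
      (hmsmall vH _ (hCk vH)).trans
        (mul_le_mul_of_nonneg_left (hCkstab vH) (mul_nonneg hδ hn))
    have h₂ : |m (Ck vH) (Ck vH)| ≤ δ * n * n :=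
      (hmsmall _ _ (hCk vH)).trans
        (mul_le_mul (mul_le_mul_of_nonneg_left (hCkstab vH) hδ) (hCkstab vH)
          (Real.sqrt_nonneg _) (mul_nonneg hδ hn))
    have hexp : 1 - m vH vH = m (Ck vH) (Ck vH) - 2 * m vH (Ck vH) := by
      rw [← hnorm]
      simp only [map_sub, LinearMap.sub_apply, hm (Ck vH) vH]
      ring
    have hrest : 0 ≤ δ * (4 * g + g ^ 2) * n ^ 2 := by positivity
    rw [abs_le] at h₁ h₂
    rw [hexp, abs_le]
    constructor <;> linarith [h₁.1, h₁.2, h₂.1, h₂.2]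
  have hΛmass : Λ * (1 - m vH vH) ≤ |Λ| * (δ * (3 + 4 * g + g ^ 2)) * n ^ 2 :=
    calc Λ * (1 - m vH vH) ≤ |Λ| * |1 - m vH vH| := (le_abs_self _).trans (abs_mul _ _).le
      _ ≤ |Λ| * (δ * (3 + 4 * g + g ^ 2) * n ^ 2) :=
          mul_le_mul_of_nonneg_left hmass (abs_nonneg _)
      _ = |Λ| * (δ * (3 + 4 * g + g ^ 2)) * n ^ 2 := by ring
  linarith
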